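/- Let G be a discrete group with a length function |·| such that the pair (G, |·|) has property (J). Then there exists a constant N > 0, depending only on (G, |·|), such that for every complex Hilbert space H, every norm-closed self-adjoint subalgebra A of B(H), every action α of G on A by *-automorphisms, every integer k ≥ 0, and every finitely supported X : G → A whose support is contained in C_k, one has ‖T_X‖ ≤ N (1+k) ( Σ_{g∈C_k} ‖X(g)‖² )^{1/2}. -/

import Mathlib

/-- A length function on a group `G`. -/
structure IsLengthFunction {G : Type*} [Group G] (ℓ : G → ℝ) : Prop where
  nonneg : ∀ g, 0 ≤ ℓ g
  one : ℓ 1 = 0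
  inv : ∀ g, ℓ g⁻¹ = ℓ g
  subadd : ∀ g h, ℓ (g * h) ≤ ℓ g + ℓ h

/-- The set `C_{t,δ} = {g : t − δ ≤ |g| ≤ t + δ}`. -/
def CJ {G : Type*} (ℓ : G → ℝ) (t δ : ℝ) : Set G := {g | t - δ ≤ ℓ g ∧ ℓ g ≤ t + δ}

/-- Property (J) for a group with a length function. -/
def HasPropertyJ {G : Type*} [Group G] (ℓ : G → ℝ) : Prop :=
  ∃ a b c : ℝ, 0 < a ∧ 0 < b ∧ 0 < c ∧
    ∃ u : G → ℝ → G,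
      (∀ g : G, ∀ s : ℝ, 0 ≤ s → s < ℓ g + 1 →
        u g s ∈ CJ ℓ s a ∧ (u g s)⁻¹ * g ∈ CJ ℓ (ℓ g + 1 - s) b) ∧
      (∀ (p : ℕ) (x y : G),
        (2 * (p : ℝ) ≤ ℓ x + ℓ y - ℓ (x * y) ∧
          ℓ x + ℓ y - ℓ (x * y) < 2 * (p : ℝ) + 2) →
        (u (x * y) (ℓ x - p))⁻¹ * x ∈ CJ ℓ p c) ∧
      (∀ μ ν : ℝ, 0 < μ → 0 < ν → ∃ N : ℕ, ∀ (y : G) (p : ℕ), (p : ℝ) ≤ ℓ y →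
        {cv : G × G | cv.1 ∈ CJ ℓ p μ ∧ cv.2 ∈ CJ ℓ (ℓ y - p) ν ∧
            cv.1⁻¹ * cv.2 = y}.Finite ∧
        {cv : G × G | cv.1 ∈ CJ ℓ p μ ∧ cv.2 ∈ CJ ℓ (ℓ y - p) ν ∧
            cv.1⁻¹ * cv.2 = y}.ncard ≤ N)

open scoped NNReal ENNReal

/-- Summing a constant over a set of cardinality at most `N`. -/
theorem ENNReal.tsum_ite_le_of_encard_le {β : Type*} {P : β → Prop} [DecidablePred P] {N : ℕ}
    (hP : {b | P b}.encard ≤ N) (c : ℝ≥0∞) : ∑' b, (if P b then c else 0) ≤ N * c := by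
  have h : ∑' b, (if P b then c else 0) = ∑' _ : {b | P b}, c := by
    rw [tsum_subtype {b | P b} (fun _ => c)]
    simp [Set.indicator_apply]
  rw [h, ENNReal.tsum_set_const]
  gcongr
  exact_mod_cast ENat.toENNReal_mono hP

/-- An `ℓ²` bound for a partial convolution whose factorizations `h = x * (x⁻¹ * h)` are routed
through an intermediate point `u h x`, with uniformly bounded multiplicities. -/
theorem tsum_sq_partial_convolution_le {G : Type*} [Group G] [DecidableEq G]
    {F : Finset G} {S : G → Finset G} (hS : ∀ h, S h ⊆ F) (u : G → G → G)
    {P Q : G → G → Prop} {N₁ N₂ N₃ : ℕ}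
    (hu : ∀ h, ((S h).image (u h)).card ≤ N₁)
    (hP : ∀ h, ∀ x ∈ S h, P (u h x) x)
    (hQ : ∀ h, ∀ x ∈ S h, Q ((u h x)⁻¹ * h) (x⁻¹ * h))
    (hPcard : ∀ x, {v | P v x}.encard ≤ N₂) (hQcard : ∀ y, {v | Q v y}.encard ≤ N₃)
    (φ ψ : G → ℝ≥0) :
    ∑' h, ((∑ x ∈ S h, φ x * ψ (x⁻¹ * h) : ℝ≥0) : ℝ≥0∞) ^ 2 ≤
      N₁ * (N₂ * ∑ x ∈ F, (φ x : ℝ≥0∞) ^ 2) * (N₃ * ∑' y, (ψ y : ℝ≥0∞) ^ 2) := by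
  classical
  set Φ : G → ℝ≥0∞ := fun v => ∑ x ∈ F, if P v x then (φ x : ℝ≥0∞) ^ 2 else 0 with hΦ
  set Ψ : G → ℝ≥0∞ := fun v => ∑' y, if Q v y then (ψ y : ℝ≥0∞) ^ 2 else 0 with hΨ
  have hΦsum : ∑' v, Φ v ≤ N₂ * ∑ x ∈ F, (φ x : ℝ≥0∞) ^ 2 := by
    rw [hΦ, Summable.tsum_finsetSum (fun _ _ => ENNReal.summable), Finset.mul_sum]
    exact Finset.sum_le_sum fun x _ => ENNReal.tsum_ite_le_of_encard_le (hPcard x) _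
  have hΨsum : ∑' v, Ψ v ≤ N₃ * ∑' y, (ψ y : ℝ≥0∞) ^ 2 := by
    rw [hΨ, ENNReal.tsum_comm, ← ENNReal.tsum_mul_left]
    exact ENNReal.tsum_le_tsum fun y => ENNReal.tsum_ite_le_of_encard_le (hQcard y) _
  have hpoint : ∀ h, ((∑ x ∈ S h, φ x * ψ (x⁻¹ * h) : ℝ≥0) : ℝ≥0∞) ^ 2 ≤
      N₁ * ∑' v, Φ v * Ψ (v⁻¹ * h) := by
    intro h
    have hcs : (∑ x ∈ S h, φ x * ψ (x⁻¹ * h)) ^ 2 ≤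
        N₁ * ∑ v ∈ (S h).image (u h), (∑ x ∈ S h with u h x = v, φ x ^ 2) *
          ∑ x ∈ S h with u h x = v, ψ (x⁻¹ * h) ^ 2 := by
      rw [← Finset.sum_fiberwise_of_maps_to (t := (S h).image (u h)) (g := u h)
        (fun x hx => Finset.mem_image_of_mem _ hx)]
      refine sq_sum_le_card_mul_sum_sq.trans ?_
      gcongr with v hv
      · exact_mod_cast hu h
      · exact Finset.sum_mul_sq_le_sq_mul_sq _ _ _
    have hcs' : ((∑ x ∈ S h, φ x * ψ (x⁻¹ * h) : ℝ≥0) : ℝ≥0∞) ^ 2 ≤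
        N₁ * ∑ v ∈ (S h).image (u h), (∑ x ∈ S h with u h x = v, (φ x : ℝ≥0∞) ^ 2) *
          ∑ x ∈ S h with u h x = v, (ψ (x⁻¹ * h) : ℝ≥0∞) ^ 2 := by
      exact_mod_cast hcs
    refine hcs'.trans ?_
    gcongr
    refine le_trans ?_ (ENNReal.sum_le_tsum ((S h).image (u h)))
    gcongr with v hv
    · simp only [hΦ]
      rw [← Finset.sum_filter]
      refine Finset.sum_le_sum_of_subset fun x hx => ?_
      obtain ⟨hxS, rfl⟩ := Finset.mem_filter.1 hx
      exact Finset.mem_filter.2 ⟨hS h hxS, hP h x hxS⟩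
    · have hinj : Set.InjOn (fun x => x⁻¹ * h) ((S h).filter (u h · = v) : Set G) := by
        intro x _ y _ hxy
        simpa using hxy
      rw [← Finset.sum_image (f := fun y => (ψ y : ℝ≥0∞) ^ 2) hinj]
      refine le_trans (Finset.sum_le_sum fun y hy => ?_) (ENNReal.sum_le_tsum _)
      obtain ⟨x, hx, rfl⟩ := Finset.mem_image.1 hy
      obtain ⟨hxS, rfl⟩ := Finset.mem_filter.1 hx
      rw [if_pos (hQ h x hxS)]
  calc _ ≤ ∑' h, N₁ * ∑' v, Φ v * Ψ (v⁻¹ * h) := ENNReal.tsum_le_tsum hpoint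
    _ = N₁ * ((∑' v, Φ v) * ∑' v, Ψ v) := by
      rw [ENNReal.tsum_mul_left, ENNReal.tsum_comm, ← ENNReal.tsum_mul_right]
      congr 2 with v
      rw [ENNReal.tsum_mul_left, ← (Equiv.mulLeft v⁻¹).tsum_eq Ψ]
      rfl
    _ ≤ _ := by
      rw [mul_assoc]
      gcongr

/-- Counting consequence of the last clause of property (J), with a real parameter in place of the
integer one. -/
theorem exists_encard_le_of_count {G : Type*} [Group G] {ℓ : G → ℝ}
    (hfin : ∀ μ ν : ℝ, 0 < μ → 0 < ν → ∃ N : ℕ, ∀ (y : G) (p : ℕ), (p : ℝ) ≤ ℓ y →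
        {cv : G × G | cv.1 ∈ CJ ℓ p μ ∧ cv.2 ∈ CJ ℓ (ℓ y - p) ν ∧
            cv.1⁻¹ * cv.2 = y}.Finite ∧
        {cv : G × G | cv.1 ∈ CJ ℓ p μ ∧ cv.2 ∈ CJ ℓ (ℓ y - p) ν ∧
            cv.1⁻¹ * cv.2 = y}.ncard ≤ N)
    (hnonneg : ∀ g, 0 ≤ ℓ g) {μ ν : ℝ} (hμ : 0 < μ) (hν : 0 < ν) :
    ∃ N : ℕ, ∀ (y : G) (t : ℝ), 0 ≤ t → t ≤ ℓ y + 1 →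
      {g : G | g ∈ CJ ℓ t μ ∧ g * y ∈ CJ ℓ (ℓ y - t) ν}.encard ≤ N := by
  obtain ⟨N, hN⟩ := hfin (μ + 2) (ν + 2) (by linarith) (by linarith)
  refine ⟨N, fun y t ht hty => ?_⟩
  set p : ℕ := ⌊min t (ℓ y)⌋₊ with hp
  have hmin : 0 ≤ min t (ℓ y) := le_min ht (hnonneg y)
  have hp₁ : (p : ℝ) ≤ min t (ℓ y) := Nat.floor_le hmin
  have hp₂ : min t (ℓ y) < p + 1 := Nat.lt_floor_add_one _
  have hpt : (p : ℝ) ≤ t := hp₁.trans (min_le_left _ _)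
  have htp : t ≤ p + 2 := by
    rcases min_choice t (ℓ y) with h | h <;> rw [h] at hp₂ <;> linarith
  obtain ⟨hf, hc⟩ := hN y p (hp₁.trans (min_le_right _ _))
  rw [← Nat.cast_le (α := ℕ∞), hf.cast_ncard_eq] at hc
  refine (Set.encard_le_encard_of_injOn (f := fun g => (g, g * y)) ?_ ?_).trans hc
  · rintro g ⟨⟨h₁, h₂⟩, h₃, h₄⟩
    refine ⟨⟨?_, ?_⟩, ⟨?_, ?_⟩, by simp⟩ <;> dsimp only <;> linarith
  · intro g _ g' _ h
    exact congrArg Prod.fst h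

/-- Property (J) implies a Haagerup-type inequality for convolution by nonnegative functions
supported on a sphere. -/
theorem HasPropertyJ.exists_convolution_bound {G : Type*} [Group G] {ℓ : G → ℝ}
    (hℓ : IsLengthFunction ℓ) (hJ : HasPropertyJ ℓ) :
    ∃ N : ℕ, ∀ (k : ℕ) (F : Finset G), (∀ g ∈ F, (k : ℝ) - 1 < ℓ g ∧ ℓ g ≤ k) →
      ∀ φ ψ : G → ℝ≥0,
        ∑' h, ((∑ x ∈ F, φ x * ψ (x⁻¹ * h) : ℝ≥0) : ℝ≥0∞) ^ 2 ≤
          (1 + k) ^ 2 * N * (∑ x ∈ F, (φ x : ℝ≥0∞) ^ 2) * ∑' y, (ψ y : ℝ≥0∞) ^ 2 := by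
  classical
  obtain ⟨a, b, c, ha, hb, hc, u, hu, hcanc, hfin⟩ := hJ
  obtain ⟨N₁, hN₁⟩ := exists_encard_le_of_count hfin hℓ.nonneg
    (μ := a + 1) (ν := b + 2) (by linarith) (by linarith)
  obtain ⟨N₂, hN₂⟩ := exists_encard_le_of_count hfin hℓ.nonneg ha hc
  obtain ⟨N₃, hN₃⟩ := exists_encard_le_of_count hfin hℓ.nonneg
    (μ := c) (ν := b + 1) hc (by linarith)
  refine ⟨N₁ * N₂ * N₃, fun k F hF φ ψ => ?_⟩
  -- twice the cancellation of the factorization `h = x * (x⁻¹ * h)`, up to rounding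
  set d : G → G → ℝ := fun h x => ℓ x + ℓ (x⁻¹ * h) - ℓ h with hd
  have hd₀ : ∀ h x, 0 ≤ d h x := fun h x => by
    have := hℓ.subadd x (x⁻¹ * h)
    rw [mul_inv_cancel_left] at this
    simp only [hd]; linarith
  have hd₁ : ∀ h x, d h x ≤ 2 * ℓ x := fun h x => by
    have := hℓ.subadd x⁻¹ h
    rw [hℓ.inv] at this
    simp only [hd]; linarith
  have hd₂ : ∀ h x, d h x ≤ 2 * ℓ (x⁻¹ * h) := fun h x => by
    have := hℓ.subadd h (x⁻¹ * h)⁻¹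
    rw [hℓ.inv] at this
    simp only [mul_inv_rev, inv_inv, mul_inv_cancel_left] at this
    simp only [hd]; linarith
  set n : G → G → ℕ := fun h x => ⌊d h x / 2⌋₊ with hn
  have hn₁ : ∀ h x, 2 * (n h x : ℝ) ≤ d h x := fun h x => by
    have := Nat.floor_le (show 0 ≤ d h x / 2 by linarith [hd₀ h x])
    simp only [hn]; linarith
  have hn₂ : ∀ h x, d h x < 2 * (n h x : ℝ) + 2 := fun h x => by
    have := Nat.lt_floor_add_one (d h x / 2)
    simp only [hn]; linarith
  have hnx : ∀ h x, (n h x : ℝ) ≤ ℓ x := fun h x => by linarith [hn₁ h x, hd₁ h x]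
  have hny : ∀ h x, (n h x : ℝ) ≤ ℓ (x⁻¹ * h) := fun h x => by linarith [hn₁ h x, hd₂ h x]
  have hlt : ∀ h x, ℓ x - n h x < ℓ h + 1 := fun h x => by
    have h₁ := hn₂ h x
    have h₂ := hℓ.subadd h (x⁻¹ * h)⁻¹
    rw [hℓ.inv] at h₂
    simp only [mul_inv_rev, inv_inv, mul_inv_cancel_left] at h₂
    simp only [hd] at h₁
    linarith
  have hU : ∀ h x, u h (ℓ x - n h x) ∈ CJ ℓ (ℓ x - n h x) a ∧
      (u h (ℓ x - n h x))⁻¹ * h ∈ CJ ℓ (ℓ h + 1 - (ℓ x - n h x)) b :=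
    fun h x => hu h _ (by linarith [hnx h x]) (hlt h x)
  have hC : ∀ h x, (u h (ℓ x - n h x))⁻¹ * x ∈ CJ ℓ (n h x) c := fun h x => by
    have := hcanc (n h x) x (x⁻¹ * h)
    rw [mul_inv_cancel_left] at this
    exact this ⟨hn₁ h x, hn₂ h x⟩
  have hmain : ∀ p : ℕ,
      ∑' h, ((∑ x ∈ F with n h x = p, φ x * ψ (x⁻¹ * h) : ℝ≥0) : ℝ≥0∞) ^ 2 ≤
        N₁ * (N₂ * ∑ x ∈ F, (φ x : ℝ≥0∞) ^ 2) * (N₃ * ∑' y, (ψ y : ℝ≥0∞) ^ 2) := by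
    intro p
    refine tsum_sq_partial_convolution_le (S := fun h => F.filter (n h · = p))
      (fun h => Finset.filter_subset _ _) (fun h x => u h (ℓ x - n h x))
      (P := fun v x => (p : ℝ) ≤ ℓ x ∧ v ∈ CJ ℓ (ℓ x - p) a ∧ v⁻¹ * x ∈ CJ ℓ p c)
      (Q := fun v y => (p : ℝ) ≤ ℓ y ∧ v * y⁻¹ ∈ CJ ℓ p c ∧ v ∈ CJ ℓ (ℓ y - p) (b + 1))
      ?_ ?_ ?_ ?_ ?_ φ ψ
    · intro h
      rcases (F.filter (n h · = p)).eq_empty_or_nonempty with he | ⟨x₀, hx₀⟩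
      · simp [he]
      obtain ⟨hx₀F, rfl⟩ := Finset.mem_filter.1 hx₀
      have hcount := hN₁ h (ℓ x₀ - n h x₀) (by linarith [hnx h x₀]) (hlt h x₀).le
      rw [← Nat.cast_le (α := ℕ∞), ← Set.encard_coe_eq_coe_finsetCard]
      refine (Set.encard_le_encard_of_injOn (f := fun g => g⁻¹) ?_
        (inv_injective.injOn)).trans hcount
      intro v hv
      obtain ⟨x, hx, rfl⟩ := Finset.mem_image.1 (Finset.mem_coe.1 hv)
      obtain ⟨hxF, hnn⟩ := Finset.mem_filter.1 hx
      obtain ⟨⟨h₁, h₂⟩, h₃, h₄⟩ := hU h x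
      rw [hnn] at h₁ h₂ h₃ h₄ ⊢
      obtain ⟨h₅, h₆⟩ := hF x hxF
      obtain ⟨h₇, h₈⟩ := hF x₀ hx₀F
      refine ⟨⟨?_, ?_⟩, ?_, ?_⟩ <;> simp only [hℓ.inv] <;> linarith
    · intro h x hx
      obtain ⟨hxF, rfl⟩ := Finset.mem_filter.1 hx
      exact ⟨hnx h x, (hU h x).1, hC h x⟩
    · intro h x hx
      obtain ⟨hxF, rfl⟩ := Finset.mem_filter.1 hx
      refine ⟨hny h x, ?_, ?_⟩
      · simpa [mul_assoc] using hC h x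
      · obtain ⟨h₁, h₂⟩ := (hU h x).2
        have h₃ := hn₁ h x
        have h₄ := hn₂ h x
        simp only [hd] at h₃ h₄
        constructor <;> linarith
    · intro x
      by_cases hpx : (p : ℝ) ≤ ℓ x
      · refine (Set.encard_le_encard_of_injOn (f := fun g => g⁻¹) ?_
          (inv_injective.injOn)).trans
          (hN₂ x (ℓ x - p) (by linarith) (by linarith [Nat.cast_nonneg (α := ℝ) p]))
        rintro v ⟨-, ⟨h₁, h₂⟩, h₃⟩
        refine ⟨⟨?_, ?_⟩, ?_⟩
        · simpa only [hℓ.inv] using h₁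
        · simpa only [hℓ.inv] using h₂
        · simpa using h₃
      · simp [hpx]
    · intro y
      by_cases hpy : (p : ℝ) ≤ ℓ y
      · refine (Set.encard_le_encard_of_injOn (f := fun g => g * y⁻¹) ?_
          ((mul_left_injective _).injOn)).trans
          (hN₃ y p (Nat.cast_nonneg _) (by linarith))
        rintro v ⟨-, h₁, h₂⟩
        exact ⟨h₁, by simpa using h₂⟩
      · simp [hpy]
  have hsplit : ∀ h, ((∑ x ∈ F, φ x * ψ (x⁻¹ * h) : ℝ≥0) : ℝ≥0∞) ^ 2 ≤
      (1 + k) * ∑ p ∈ Finset.range (k + 1),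
        ((∑ x ∈ F with n h x = p, φ x * ψ (x⁻¹ * h) : ℝ≥0) : ℝ≥0∞) ^ 2 := by
    intro h
    have hmaps : ∀ x ∈ F, n h x ∈ Finset.range (k + 1) := fun x hx => by
      rw [Finset.mem_range, Nat.lt_succ_iff, ← Nat.cast_le (α := ℝ)]
      exact (hnx h x).trans (hF x hx).2
    have := sq_sum_le_card_mul_sum_sq (s := Finset.range (k + 1))
      (f := fun p => ∑ x ∈ F with n h x = p, φ x * ψ (x⁻¹ * h))
    rw [Finset.sum_fiberwise_of_maps_to hmaps, Finset.card_range, add_comm k 1] at this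
    rw [add_comm k 1]
    exact_mod_cast this
  calc _ ≤ ∑' h, (1 + k) * ∑ p ∈ Finset.range (k + 1),
        ((∑ x ∈ F with n h x = p, φ x * ψ (x⁻¹ * h) : ℝ≥0) : ℝ≥0∞) ^ 2 :=
        ENNReal.tsum_le_tsum hsplit
    _ = (1 + k) * ∑ p ∈ Finset.range (k + 1), ∑' h,
        ((∑ x ∈ F with n h x = p, φ x * ψ (x⁻¹ * h) : ℝ≥0) : ℝ≥0∞) ^ 2 := by
      rw [ENNReal.tsum_mul_left, Summable.tsum_finsetSum (fun _ _ => ENNReal.summable)]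
    _ ≤ (1 + k) * ∑ p ∈ Finset.range (k + 1),
        (N₁ * (N₂ * ∑ x ∈ F, (φ x : ℝ≥0∞) ^ 2) * (N₃ * ∑' y, (ψ y : ℝ≥0∞) ^ 2)) := by
      gcongr with p
      exact hmain p
    _ = _ := by
      rw [Finset.sum_const, Finset.card_range, nsmul_eq_mul]
      push_cast
      ring

/-- The squared norm on `ℓ²` as an extended nonnegative sum. -/
theorem lp.tsum_nnnorm_sq {ι : Type*} {E : ι → Type*} [∀ i, NormedAddCommGroup (E i)]
    (f : lp E 2) : ∑' i, (‖f i‖₊ : ℝ≥0∞) ^ 2 = (‖f‖₊ : ℝ≥0∞) ^ 2 := by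
  have h := lp.hasSum_norm (p := 2) (by norm_num) f
  simp only [ENNReal.toReal_ofNat, Real.rpow_ofNat, ← coe_nnnorm] at h
  have h' : HasSum (fun i => ‖f i‖₊ ^ 2) (‖f‖₊ ^ 2) := by exact_mod_cast h
  exact_mod_cast (ENNReal.hasSum_coe.2 h').tsum_eq

/-- If `(G,|·|)` has property (J), there is `N > 0` such that for any action of `G` by
*-automorphisms on a norm-closed self-adjoint subalgebra `A ⊆ B(H)` and any finitely supported
`X : G → A` with support in `C_k`, the operator `T_X` on `ℓ²(G,H)` (representing
`Σ_g L_g X(g)` in `C*_r(A ⋊_α G)`) satisfies `‖T_X‖ ≤ N(1+k)(Σ_{g∈C_k} ‖X(g)‖²)^{1/2}`. -/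
theorem propertyJ_Ck_norm_bound {G : Type*} [Group G] (ℓ : G → ℝ)
    (hℓ : IsLengthFunction ℓ) (hJ : HasPropertyJ ℓ) :
    ∃ N : ℝ, 0 < N ∧
      ∀ (H : Type*) [NormedAddCommGroup H] [InnerProductSpace ℂ H] [CompleteSpace H]
        (A : NonUnitalStarSubalgebra ℂ (H →L[ℂ] H)),
        IsClosed (A : Set (H →L[ℂ] H)) →
      ∀ α : G → (A ≃⋆ₐ[ℂ] A), (∀ x, α 1 x = x) →
        (∀ g h x, α (g * h) x = α g (α h x)) →
      ∀ (k : ℕ) (X : G →₀ A),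
        (∀ g ∈ X.support, (k : ℝ) - 1 < ℓ g ∧ ℓ g ≤ (k : ℝ)) →
        ∀ T : lp (fun _ : G => H) 2 →L[ℂ] lp (fun _ : G => H) 2,
          (∀ (ξ : lp (fun _ : G => H) 2) (h : G),
            (T ξ : ∀ _ : G, H) h = ∑ g ∈ X.support,
              ((α (h⁻¹ * g) (X g) : H →L[ℂ] H) ((ξ : ∀ _ : G, H) (g⁻¹ * h)))) →
          ‖T‖ ≤ N * (1 + (k : ℝ)) *
            Real.sqrt (∑ g ∈ X.support, ‖(X g : H →L[ℂ] H)‖ ^ 2) := by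
  classical
  obtain ⟨N, hN⟩ := hJ.exists_convolution_bound hℓ
  refine ⟨Real.sqrt N + 1, by positivity, ?_⟩
  intro H _ _ _ A hA α _ _ k X hX T hT
  have : IsClosed (A : Set (H →L[ℂ] H)) := hA
  have hα : ∀ g x, ‖α g x‖₊ = ‖x‖₊ := fun g x => StarAlgEquiv.nnnorm_map (α g) x
  refine T.opNorm_le_bound (by positivity) fun ξ => ?_
  have hpoint : ∀ h, ‖T ξ h‖₊ ≤ ∑ g ∈ X.support, ‖X g‖₊ * ‖ξ (g⁻¹ * h)‖₊ := fun h => by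
    rw [hT]
    refine (nnnorm_sum_le _ _).trans (Finset.sum_le_sum fun g _ => ?_)
    rw [← hα (h⁻¹ * g)]
    exact ContinuousLinearMap.le_opNNNorm _ _
  have hsq : (‖T ξ‖₊ : ℝ≥0∞) ^ 2 ≤
      (1 + k) ^ 2 * N * (∑ g ∈ X.support, (‖X g‖₊ : ℝ≥0∞) ^ 2) * (‖ξ‖₊ : ℝ≥0∞) ^ 2 := by
    rw [← lp.tsum_nnnorm_sq (T ξ), ← lp.tsum_nnnorm_sq ξ]
    refine le_trans (ENNReal.tsum_le_tsum fun h => ?_)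
      (hN k X.support hX (fun g => ‖X g‖₊) (fun g => ‖ξ g‖₊))
    gcongr
    exact hpoint h
  have hreal : ‖T ξ‖ ^ 2 ≤
      (1 + k) ^ 2 * N * (∑ g ∈ X.support, ‖(X g : H →L[ℂ] H)‖ ^ 2) * ‖ξ‖ ^ 2 := by
    have hsq' : ‖T ξ‖₊ ^ 2 ≤
        (1 + k) ^ 2 * N * (∑ g ∈ X.support, ‖X g‖₊ ^ 2) * ‖ξ‖₊ ^ 2 := by
      exact_mod_cast hsq
    simpa using NNReal.coe_le_coe.2 hsq'
  have hsum : 0 ≤ ∑ g ∈ X.support, ‖(X g : H →L[ℂ] H)‖ ^ 2 := by positivity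
  calc ‖T ξ‖ ≤ Real.sqrt N * (1 + k) *
        Real.sqrt (∑ g ∈ X.support, ‖(X g : H →L[ℂ] H)‖ ^ 2) * ‖ξ‖ := by
        refine (pow_le_pow_iff_left₀ (norm_nonneg _) (by positivity) two_ne_zero).1 ?_
        rw [mul_pow, mul_pow, mul_pow, Real.sq_sqrt hsum, Real.sq_sqrt (Nat.cast_nonneg N)]
        linarith
    _ ≤ _ := by gcongr; linarith
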